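/- arXiv:2409.08563 — 3 statements merged into one kernel-verified Lean document; each statement's English description precedes it below -/
import Mathlib

section
/- The sum of the two projection matrices admits the explicit spectral decomposition ΦΦᵀ + ΨΨᵀ = M(I_d + Σ)Mᵀ + D(I_d − Σ)Dᵀ, where M = (ΦU + ΨV)(2(I_d + Σ))^{−1/2} and D = (ΦU − ΨV)(2(I_d − Σ))^{−1/2}; that is, the columns of M and D together form an orthonormal eigenbasis of ΦΦᵀ + ΨΨᵀ with eigenvalues 1 + cos θ_i and 1 − cos θ_i respectively. -/
open Matrix

/-- Conjugating `1 + diagonal σ` by `(2(1 + diagonal σ))^{-1/2}` gives `1/2`. -/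
theorem diagonal_inv_sqrt_conj {ι : Type*} [Fintype ι] [DecidableEq ι] (σ : ι → ℝ)
    (hσ : ∀ i, -1 < σ i) :
    diagonal (fun i => (Real.sqrt (2 * (1 + σ i)))⁻¹) * (1 + diagonal σ) *
      diagonal (fun i => (Real.sqrt (2 * (1 + σ i)))⁻¹) = (1 / 2 : ℝ) • (1 : Matrix ι ι ℝ) := by
  rw [← diagonal_one, diagonal_add, diagonal_mul_diagonal, diagonal_mul_diagonal,
    ← diagonal_smul]
  congr 1
  funext i
  have hpos : 0 < 1 + σ i := by linarith [hσ i]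
  have hsq : Real.sqrt (2 * (1 + σ i)) ^ 2 = 2 * (1 + σ i) := Real.sq_sqrt (by positivity)
  have hne : Real.sqrt (2 * (1 + σ i)) ≠ 0 := (Real.sqrt_pos.mpr (by positivity)).ne'
  simp only [Pi.smul_apply, smul_eq_mul]
  field_simp
  linarith

/-- If `A`, `B` have orthonormal columns and `AᵀB = BᵀA = diagonal σ`, then the normalized sum
`(A + B)(2(1 + diagonal σ))^{-1/2}` has orthonormal columns. -/
theorem normalized_sum_transpose_mul_self {m ι : Type*} [Fintype m] [Fintype ι] [DecidableEq ι]
    {A B : Matrix m ι ℝ} {σ : ι → ℝ} (hA : Aᵀ * A = 1) (hB : Bᵀ * B = 1)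
    (hAB : Aᵀ * B = diagonal σ) (hBA : Bᵀ * A = diagonal σ) (hσ : ∀ i, -1 < σ i) :
    ((A + B) * diagonal (fun i => (Real.sqrt (2 * (1 + σ i)))⁻¹))ᵀ *
      ((A + B) * diagonal (fun i => (Real.sqrt (2 * (1 + σ i)))⁻¹)) = 1 := by
  have hgram : (A + B)ᵀ * (A + B) = (2 : ℝ) • (1 + diagonal σ) := by
    rw [transpose_add, Matrix.add_mul, Matrix.mul_add, Matrix.mul_add, hA, hB, hAB, hBA, two_smul]
    abel
  rw [transpose_mul, diagonal_transpose, Matrix.mul_assoc, ← Matrix.mul_assoc _ (A + B), hgram,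
    ← Matrix.mul_assoc, Matrix.mul_smul, Matrix.smul_mul, diagonal_inv_sqrt_conj σ hσ, smul_smul]
  norm_num

theorem normalized_sum_mul_mul_transpose {m ι : Type*} [Fintype ι] [DecidableEq ι]
    (E : Matrix m ι ℝ) {σ : ι → ℝ} (hσ : ∀ i, -1 < σ i) :
    (E * diagonal (fun i => (Real.sqrt (2 * (1 + σ i)))⁻¹)) * (1 + diagonal σ) *
      (E * diagonal (fun i => (Real.sqrt (2 * (1 + σ i)))⁻¹))ᵀ = (1 / 2 : ℝ) • (E * Eᵀ) := by
  have h := congrArg (fun X => E * X * Eᵀ) (diagonal_inv_sqrt_conj σ hσ)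
  simpa only [transpose_mul, diagonal_transpose, Matrix.mul_assoc, Matrix.mul_smul,
    Matrix.smul_mul, Matrix.one_mul] using h

/-- The sum of the two projection matrices has the explicit spectral
decomposition `ΦΦᵀ + ΨΨᵀ = M(I + Σ)Mᵀ + D(I − Σ)Dᵀ`, where
`M = (ΦU + ΨV)(2(I + Σ))^{−1/2}` and `D = (ΦU − ΨV)(2(I − Σ))^{−1/2}`; moreover the columns of
`M` and `D` together form an orthonormal eigenbasis of `ΦΦᵀ + ΨΨᵀ` with eigenvalues
`1 + cos θᵢ` and `1 − cos θᵢ` respectively. -/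
theorem second_order_DS_stmt5 {n d : ℕ}
    (Φ Ψ : Matrix (Fin n) (Fin d) ℝ) (U V : Matrix (Fin d) (Fin d) ℝ)
    (σ : Fin d → ℝ)
    (hΦ : Φᵀ * Φ = 1) (hΨ : Ψᵀ * Ψ = 1)
    (hU : Uᵀ * U = 1) (hU' : U * Uᵀ = 1)
    (hV : Vᵀ * V = 1) (hV' : V * Vᵀ = 1)
    (hσ : ∀ i, 0 ≤ σ i ∧ σ i < 1)
    (hSVD : Φᵀ * Ψ = U * Matrix.diagonal σ * Vᵀ)
    (M D : Matrix (Fin n) (Fin d) ℝ)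
    (hM : M = (Φ * U + Ψ * V) * Matrix.diagonal (fun i => (Real.sqrt (2 * (1 + σ i)))⁻¹))
    (hD : D = (Φ * U - Ψ * V) * Matrix.diagonal (fun i => (Real.sqrt (2 * (1 - σ i)))⁻¹)) :
    Φ * Φᵀ + Ψ * Ψᵀ
        = M * (1 + Matrix.diagonal σ) * Mᵀ + D * (1 - Matrix.diagonal σ) * Dᵀ ∧
    Mᵀ * M = 1 ∧ Dᵀ * D = 1 ∧ Mᵀ * D = 0 ∧
    (Φ * Φᵀ + Ψ * Ψᵀ) * M = M * (1 + Matrix.diagonal σ) ∧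
    (Φ * Φᵀ + Ψ * Ψᵀ) * D = D * (1 - Matrix.diagonal σ) := by
  have hA : (Φ * U)ᵀ * (Φ * U) = 1 := by
    rw [transpose_mul, Matrix.mul_assoc, ← Matrix.mul_assoc Φᵀ, hΦ, Matrix.one_mul, hU]
  have hB : (Ψ * V)ᵀ * (Ψ * V) = 1 := by
    rw [transpose_mul, Matrix.mul_assoc, ← Matrix.mul_assoc Ψᵀ, hΨ, Matrix.one_mul, hV]
  have hAB : (Φ * U)ᵀ * (Ψ * V) = diagonal σ := by
    rw [transpose_mul, Matrix.mul_assoc, ← Matrix.mul_assoc Φᵀ, hSVD, Matrix.mul_assoc _ Vᵀ, hV,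
      Matrix.mul_one, ← Matrix.mul_assoc, hU, Matrix.one_mul]
  have hBA : (Ψ * V)ᵀ * (Φ * U) = diagonal σ := by
    simpa using congrArg transpose hAB
  have hAA : Φ * Φᵀ = (Φ * U) * (Φ * U)ᵀ := by
    rw [transpose_mul, Matrix.mul_assoc, ← Matrix.mul_assoc U, hU', Matrix.one_mul]
  have hBB : Ψ * Ψᵀ = (Ψ * V) * (Ψ * V)ᵀ := by
    rw [transpose_mul, Matrix.mul_assoc, ← Matrix.mul_assoc V, hV', Matrix.one_mul]
  rw [hAA, hBB]
  generalize Φ * U = A at *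
  generalize Ψ * V = B at *
  have hpos : ∀ i, -1 < σ i := fun i => by linarith [(hσ i).1]
  have hneg : ∀ i, -1 < (-σ) i := fun i => by simpa using (hσ i).2
  have hD' : D = (A + -B) * diagonal (fun i => (Real.sqrt (2 * (1 + (-σ) i)))⁻¹) := by
    simpa only [Pi.neg_apply, ← sub_eq_add_neg] using hD
  have hS : (1 : Matrix (Fin d) (Fin d) ℝ) - diagonal σ = 1 + diagonal (-σ) := by
    rw [sub_eq_add_neg, diagonal_neg]; rfl
  have hMM : Mᵀ * M = 1 := by
    rw [hM]; exact normalized_sum_transpose_mul_self hA hB hAB hBA hpos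
  have hDD : Dᵀ * D = 1 := by
    rw [hD']
    refine normalized_sum_transpose_mul_self hA ?_ ?_ ?_ hneg
    · simpa using hB
    · rw [Matrix.mul_neg, hAB, diagonal_neg]; rfl
    · rw [transpose_neg, Matrix.neg_mul, hBA, diagonal_neg]; rfl
  have hMD : Mᵀ * D = 0 := by
    have hcross : (A + B)ᵀ * (A - B) = 0 := by
      rw [transpose_add, Matrix.add_mul, Matrix.mul_sub, Matrix.mul_sub, hA, hB, hAB, hBA]
      abel
    rw [hM, hD, transpose_mul, Matrix.mul_assoc, ← Matrix.mul_assoc _ (A - B), hcross,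
      Matrix.zero_mul, Matrix.mul_zero]
  have hDM : Dᵀ * M = 0 := by
    simpa using congrArg transpose hMD
  have hdecomp : A * Aᵀ + B * Bᵀ
      = M * (1 + diagonal σ) * Mᵀ + D * (1 - diagonal σ) * Dᵀ := by
    rw [hS, hM, hD', normalized_sum_mul_mul_transpose _ hpos,
      normalized_sum_mul_mul_transpose _ hneg]
    simp only [transpose_add, transpose_neg, Matrix.add_mul, Matrix.mul_add, Matrix.neg_mul,
      Matrix.mul_neg]
    module
  refine ⟨hdecomp, hMM, hDD, hMD, ?_, ?_⟩
  · rw [hdecomp, Matrix.add_mul, Matrix.mul_assoc _ Mᵀ, Matrix.mul_assoc _ Dᵀ, hMM, hDM,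
      Matrix.mul_one, Matrix.mul_zero, add_zero]
  · rw [hdecomp, Matrix.add_mul, Matrix.mul_assoc _ Mᵀ, Matrix.mul_assoc _ Dᵀ, hMD, hDD,
      Matrix.mul_one, Matrix.mul_zero, zero_add]
end

section
/- The sum of projections admits the spectral decomposition P₁ + P₂ = 2ΓΓᵀ + ZZᵀ + M̃(I + Σ)M̃ᵀ + D̃(I − Σ)D̃ᵀ, where M̃ and D̃ are the matrices whose columns are the normalized vectors (b₁ᵢ + b₂ᵢ)/‖b₁ᵢ + b₂ᵢ‖ and (b₂ᵢ − b₁ᵢ)/‖b₂ᵢ − b₁ᵢ‖ formed from the corresponding columns b₁ᵢ of B₁ and b₂ᵢ of B₂, and Σ = B₁ᵀB₂. In particular, P₁ + P₂ has eigenvalue 2 with eigenspace S₁ ∩ S₂ of dimension r, eigenvalues 1 + cos θ_i and 1 − cos θ_i for the d₁ − r nonzero canonical angles θ_i, eigenvalue 1 with multiplicity d₂ − d₁ on the span of Z, and eigenvalue 0 on the orthogonal complement of S₁ + S₂. -/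
open Matrix Module

/-- Column-wise normalization of a matrix: each column is divided by its Euclidean norm. -/
noncomputable def colNormalize {n m : ℕ} (A : Matrix (Fin n) (Fin m) ℝ) :
    Matrix (Fin n) (Fin m) ℝ :=
  Matrix.of fun i j => A i j / Real.sqrt (∑ k, A k j ^ 2)

/-- Column normalization is right multiplication by the inverse column norms, read off from the
diagonal of the Gram matrix. -/
lemma colNormalize_eq_mul_diagonal {n m : ℕ} {A : Matrix (Fin n) (Fin m) ℝ} {g : Fin m → ℝ}
    (hA : Aᵀ * A = Matrix.diagonal g) :
    colNormalize A = A * Matrix.diagonal fun j => (√(g j))⁻¹ := by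
  ext i j
  have hg : ∑ k, A k j ^ 2 = g j := by
    simpa [Matrix.mul_apply, sq] using congrFun (congrFun hA j) j
  simp [colNormalize, hg, div_eq_mul_inv]

/-- If the columns of `A` are orthogonal with squared norms `2 * d j`, the weighted sum of the
projections onto them with weights `d j` is `(1 / 2) A Aᵀ`. -/
lemma colNormalize_mul_diagonal_mul_transpose {n m : ℕ} {A : Matrix (Fin n) (Fin m) ℝ}
    {d : Fin m → ℝ} (hd : ∀ j, 0 < d j) (hA : Aᵀ * A = Matrix.diagonal fun j => 2 * d j) :
    colNormalize A * Matrix.diagonal d * (colNormalize A)ᵀ = (1 / 2 : ℝ) • (A * Aᵀ) := by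
  have h : (fun j => (√(2 * d j))⁻¹ * d j * (√(2 * d j))⁻¹) = fun _ => (1 / 2 : ℝ) := by
    funext j
    have h2 : √(2 * d j) * √(2 * d j) = 2 * d j := Real.mul_self_sqrt (by linarith [hd j])
    have := hd j
    calc (√(2 * d j))⁻¹ * d j * (√(2 * d j))⁻¹ = d j * (√(2 * d j) * √(2 * d j))⁻¹ := by
          rw [mul_inv]; ring
      _ = 1 / 2 := by rw [h2]; field_simp
  calc colNormalize A * Matrix.diagonal d * (colNormalize A)ᵀ
      = A * (Matrix.diagonal (fun j => (√(2 * d j))⁻¹) * Matrix.diagonal d *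
          Matrix.diagonal fun j => (√(2 * d j))⁻¹) * Aᵀ := by
        rw [colNormalize_eq_mul_diagonal hA]
        simp only [Matrix.transpose_mul, Matrix.diagonal_transpose, Matrix.mul_assoc]
    _ = (1 / 2 : ℝ) • (A * Aᵀ) := by
        rw [Matrix.diagonal_mul_diagonal, Matrix.diagonal_mul_diagonal, h,
          ← Matrix.smul_one_eq_diagonal]
        simp

/-- An eigenvector equation for orthogonal columns passes to the normalized columns. -/
lemma mul_colNormalize_of_mul_eq {n m : ℕ} {P : Matrix (Fin n) (Fin n) ℝ}
    {A : Matrix (Fin n) (Fin m) ℝ} {g d : Fin m → ℝ} (hA : Aᵀ * A = Matrix.diagonal g)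
    (h : P * A = A * Matrix.diagonal d) :
    P * colNormalize A = colNormalize A * Matrix.diagonal d := by
  rw [colNormalize_eq_mul_diagonal hA, ← Matrix.mul_assoc, h, Matrix.mul_assoc, Matrix.mul_assoc,
    Matrix.diagonal_mul_diagonal, Matrix.diagonal_mul_diagonal]
  simp only [mul_comm]

/-- For a symmetric idempotent `P`, `‖x - P x‖² = ⟨x, x⟩ - ⟨x, P x⟩`. -/
lemma dotProduct_sub_mulVec_self {n : ℕ} {P : Matrix (Fin n) (Fin n) ℝ}
    (hs : Pᵀ = P) (hi : P * P = P) (x : Fin n → ℝ) :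
    (x - P *ᵥ x) ⬝ᵥ (x - P *ᵥ x) = x ⬝ᵥ x - x ⬝ᵥ (P *ᵥ x) := by
  have h : (P *ᵥ x) ⬝ᵥ (P *ᵥ x) = x ⬝ᵥ (P *ᵥ x) := by
    rw [Matrix.dotProduct_mulVec, Matrix.vecMul_mulVec, hs, hi, ← Matrix.dotProduct_mulVec]
  rw [sub_dotProduct, dotProduct_sub, dotProduct_sub, h, dotProduct_comm (P *ᵥ x) x]
  ring

/-- A vector is doubled by the sum of two orthogonal projections iff both fix it. -/
lemma add_mulVec_eq_two_smul_iff {n : ℕ} {P Q : Matrix (Fin n) (Fin n) ℝ}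
    (hPs : Pᵀ = P) (hPi : P * P = P) (hQs : Qᵀ = Q) (hQi : Q * Q = Q) (x : Fin n → ℝ) :
    (P + Q) *ᵥ x = (2 : ℝ) • x ↔ P *ᵥ x = x ∧ Q *ᵥ x = x := by
  constructor
  · intro h
    have hx : x ⬝ᵥ (P *ᵥ x) + x ⬝ᵥ (Q *ᵥ x) = 2 * (x ⬝ᵥ x) := by
      rw [← dotProduct_add, ← Matrix.add_mulVec, h, dotProduct_smul, smul_eq_mul]
    have hp := dotProduct_sub_mulVec_self hPs hPi x
    have hq := dotProduct_sub_mulVec_self hQs hQi x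
    have hp0 : 0 ≤ (x - P *ᵥ x) ⬝ᵥ (x - P *ᵥ x) :=
      Finset.sum_nonneg fun i _ => mul_self_nonneg _
    have hq0 : 0 ≤ (x - Q *ᵥ x) ⬝ᵥ (x - Q *ᵥ x) :=
      Finset.sum_nonneg fun i _ => mul_self_nonneg _
    exact ⟨(sub_eq_zero.mp (dotProduct_self_eq_zero.mp (by linarith))).symm,
      (sub_eq_zero.mp (dotProduct_self_eq_zero.mp (by linarith))).symm⟩
  · rintro ⟨hp, hq⟩
    rw [Matrix.add_mulVec, hp, hq, two_smul]

/-- A matrix that fixes the columns spanning `S` and maps into `S` has `S` as its fixed space. -/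
lemma mulVec_eq_self_iff_mem_span {n : ℕ} {P : Matrix (Fin n) (Fin n) ℝ} {s : Set (Fin n → ℝ)}
    (hfix : ∀ v ∈ s, P *ᵥ v = v) (hmem : ∀ x, P *ᵥ x ∈ Submodule.span ℝ s) (x : Fin n → ℝ) :
    P *ᵥ x = x ↔ x ∈ Submodule.span ℝ s := by
  refine ⟨fun h => h ▸ hmem x, fun h => ?_⟩
  have hle : Submodule.span ℝ s ≤ LinearMap.eqLocus P.mulVecLin LinearMap.id :=
    Submodule.span_le.mpr fun v hv => hfix v hv
  exact hle h

lemma mulVec_mem_span_range_transpose {n m : ℕ} (A : Matrix (Fin n) (Fin m) ℝ) (v : Fin m → ℝ) :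
    A *ᵥ v ∈ Submodule.span ℝ (Set.range Aᵀ) := by
  have h := LinearMap.mem_range_self A.mulVecLin v
  rwa [Matrix.range_mulVecLin] at h

lemma mulVec_eq_self_of_mem_range_transpose {n m : ℕ} {P : Matrix (Fin n) (Fin n) ℝ}
    {A : Matrix (Fin n) (Fin m) ℝ} (h : P * A = A) {v : Fin n → ℝ} (hv : v ∈ Set.range Aᵀ) :
    P *ᵥ v = v := by
  obtain ⟨j, rfl⟩ := hv
  ext i
  exact congrFun (congrFun h i) j

lemma transpose_mulVec_eq_zero {n m : ℕ} {A : Matrix (Fin n) (Fin m) ℝ} {x : Fin n → ℝ}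
    (h : ∀ y ∈ Set.range Aᵀ, x ⬝ᵥ y = 0) : Aᵀ *ᵥ x = 0 := by
  ext j
  exact (dotProduct_comm _ _).trans (h _ ⟨j, rfl⟩)

/-- In the aligned-bases setting (`[Γ B₁]` orthonormal basis of `S₁`,
`[Γ B₂ Z]` orthonormal basis of `S₂`, `B₁ᵀB₂ = Σ = diag(cos θᵢ)` with `cos θᵢ ∈ [0,1)`,
`Z ⟂ Γ, B₁, B₂`), the sum of the orthogonal projections
`P₁ = ΓΓᵀ + B₁B₁ᵀ` and `P₂ = ΓΓᵀ + B₂B₂ᵀ + ZZᵀ` admits the spectral decomposition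
`P₁ + P₂ = 2ΓΓᵀ + ZZᵀ + M̃(I + Σ)M̃ᵀ + D̃(I − Σ)D̃ᵀ`, where `M̃`, `D̃` have as columns the
normalized sums `(b₁ᵢ + b₂ᵢ)/‖b₁ᵢ + b₂ᵢ‖` and differences `(b₂ᵢ − b₁ᵢ)/‖b₂ᵢ − b₁ᵢ‖`.
In particular `P₁ + P₂` has eigenvalue `2` with eigenspace `S₁ ∩ S₂` (of dimension `r`),
eigenvalues `1 + cos θᵢ` on the columns of `M̃` and `1 − cos θᵢ` on the columns of `D̃`
(the `d₁ − r` nonzero canonical angles), eigenvalue `1` on the span of `Z`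
(multiplicity `d₂ − d₁`), and eigenvalue `0` on the orthogonal complement of `S₁ + S₂`. -/
theorem second_order_DS_stmt9 {n d₁ d₂ r : ℕ}
    (S₁ S₂ : Submodule ℝ (Fin n → ℝ))
    (hd : d₁ ≤ d₂) (hrank : finrank ℝ ↥(S₁ ⊓ S₂) = r)
    (Γ : Matrix (Fin n) (Fin r) ℝ)
    (B₁ B₂ : Matrix (Fin n) (Fin (d₁ - r)) ℝ)
    (Z : Matrix (Fin n) (Fin (d₂ - d₁)) ℝ)
    (σ : Fin (d₁ - r) → ℝ)
    (hΓ : Γᵀ * Γ = 1) (hB₁ : B₁ᵀ * B₁ = 1) (hB₂ : B₂ᵀ * B₂ = 1) (hZ : Zᵀ * Z = 1)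
    (hΓB₁ : Γᵀ * B₁ = 0) (hΓB₂ : Γᵀ * B₂ = 0)
    (hS₁ : Submodule.span ℝ (Set.range Γᵀ ∪ Set.range B₁ᵀ) = S₁)
    (hS₂ : Submodule.span ℝ (Set.range Γᵀ ∪ Set.range B₂ᵀ ∪ Set.range Zᵀ) = S₂)
    (hSig : B₁ᵀ * B₂ = Matrix.diagonal σ) (hσ : ∀ i, 0 ≤ σ i ∧ σ i < 1)
    (hΓZ : Γᵀ * Z = 0) (hB₁Z : B₁ᵀ * Z = 0) (hB₂Z : B₂ᵀ * Z = 0)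
    (P₁ P₂ : Matrix (Fin n) (Fin n) ℝ)
    (hP₁ : P₁ = Γ * Γᵀ + B₁ * B₁ᵀ)
    (hP₂ : P₂ = Γ * Γᵀ + B₂ * B₂ᵀ + Z * Zᵀ) :
    P₁ + P₂
        = (2 : ℝ) • (Γ * Γᵀ) + Z * Zᵀ
          + colNormalize (B₁ + B₂) * (1 + Matrix.diagonal σ) * (colNormalize (B₁ + B₂))ᵀ
          + colNormalize (B₂ - B₁) * (1 - Matrix.diagonal σ) * (colNormalize (B₂ - B₁))ᵀ ∧
    (∀ x : Fin n → ℝ, (P₁ + P₂).mulVec x = (2 : ℝ) • x ↔ x ∈ S₁ ⊓ S₂) ∧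
    (P₁ + P₂) * colNormalize (B₁ + B₂)
        = colNormalize (B₁ + B₂) * (1 + Matrix.diagonal σ) ∧
    (P₁ + P₂) * colNormalize (B₂ - B₁)
        = colNormalize (B₂ - B₁) * (1 - Matrix.diagonal σ) ∧
    (P₁ + P₂) * Z = Z ∧
    (∀ x : Fin n → ℝ, (∀ y ∈ S₁ ⊔ S₂, x ⬝ᵥ y = 0) → (P₁ + P₂).mulVec x = 0) := by
  have swap {k l : ℕ} {A : Matrix (Fin n) (Fin k) ℝ} {B : Matrix (Fin n) (Fin l) ℝ}
      (h : Aᵀ * B = 0) : Bᵀ * A = 0 := by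
    simpa using congrArg Matrix.transpose h
  have hSig' : B₂ᵀ * B₁ = Matrix.diagonal σ := by
    simpa using congrArg Matrix.transpose hSig
  have hB₁Γ := swap hΓB₁
  have hB₂Γ := swap hΓB₂
  have hZΓ := swap hΓZ
  have hZB₁ := swap hB₁Z
  have hZB₂ := swap hB₂Z
  have hadd : (1 : Matrix (Fin (d₁ - r)) (Fin (d₁ - r)) ℝ) + Matrix.diagonal σ
      = Matrix.diagonal fun j => 1 + σ j := by
    rw [← Matrix.diagonal_one, Matrix.diagonal_add]
  have hsub : (1 : Matrix (Fin (d₁ - r)) (Fin (d₁ - r)) ℝ) - Matrix.diagonal σ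
      = Matrix.diagonal fun j => 1 - σ j := by
    rw [← Matrix.diagonal_one, Matrix.diagonal_sub]
  have hM : (B₁ + B₂)ᵀ * (B₁ + B₂) = Matrix.diagonal fun j => 2 * (1 + σ j) := by
    have h2 : (Matrix.diagonal fun j => 2 * (1 + σ j)) = (2 : ℝ) • (1 + Matrix.diagonal σ) := by
      rw [hadd, ← Matrix.diagonal_smul]; rfl
    rw [h2, Matrix.transpose_add, Matrix.add_mul, Matrix.mul_add, Matrix.mul_add, hB₁, hB₂, hSig,
      hSig']
    module
  have hD : (B₂ - B₁)ᵀ * (B₂ - B₁) = Matrix.diagonal fun j => 2 * (1 - σ j) := by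
    have h2 : (Matrix.diagonal fun j => 2 * (1 - σ j)) = (2 : ℝ) • (1 - Matrix.diagonal σ) := by
      rw [hsub, ← Matrix.diagonal_smul]; rfl
    rw [h2, Matrix.transpose_sub, Matrix.sub_mul, Matrix.mul_sub, Matrix.mul_sub, hB₁, hB₂, hSig,
      hSig']
    module
  have hP₁Γ : P₁ * Γ = Γ := by
    simp [hP₁, Matrix.add_mul, Matrix.mul_assoc, hΓ, hB₁Γ]
  have hP₁B₁ : P₁ * B₁ = B₁ := by
    simp [hP₁, Matrix.add_mul, Matrix.mul_assoc, hΓB₁, hB₁]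
  have hP₁B₂ : P₁ * B₂ = B₁ * Matrix.diagonal σ := by
    simp [hP₁, Matrix.add_mul, Matrix.mul_assoc, hΓB₂, hSig]
  have hP₁Z : P₁ * Z = 0 := by
    simp [hP₁, Matrix.add_mul, Matrix.mul_assoc, hΓZ, hB₁Z]
  have hP₂Γ : P₂ * Γ = Γ := by
    simp [hP₂, Matrix.add_mul, Matrix.mul_assoc, hΓ, hB₂Γ, hZΓ]
  have hP₂B₁ : P₂ * B₁ = B₂ * Matrix.diagonal σ := by
    simp [hP₂, Matrix.add_mul, Matrix.mul_assoc, hΓB₁, hSig', hZB₁]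
  have hP₂B₂ : P₂ * B₂ = B₂ := by
    simp [hP₂, Matrix.add_mul, Matrix.mul_assoc, hΓB₂, hB₂, hZB₂]
  have hP₂Z : P₂ * Z = Z := by
    simp [hP₂, Matrix.add_mul, Matrix.mul_assoc, hΓZ, hB₂Z, hZ]
  refine ⟨?_, ?_, ?_, ?_, ?_, ?_⟩
  · rw [hadd, hsub, colNormalize_mul_diagonal_mul_transpose (fun j => by linarith [hσ j]) hM,
      colNormalize_mul_diagonal_mul_transpose (fun j => by linarith [hσ j]) hD, hP₁, hP₂]
    simp only [Matrix.transpose_add, Matrix.transpose_sub, Matrix.add_mul, Matrix.mul_add,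
      Matrix.sub_mul, Matrix.mul_sub]
    module
  · intro x
    have hP₁s : P₁ᵀ = P₁ := by simp [hP₁]
    have hP₂s : P₂ᵀ = P₂ := by simp [hP₂]
    have hP₁i : P₁ * P₁ = P₁ := by
      nth_rw 2 [hP₁]
      rw [Matrix.mul_add, ← Matrix.mul_assoc, ← Matrix.mul_assoc, hP₁Γ, hP₁B₁, ← hP₁]
    have hP₂i : P₂ * P₂ = P₂ := by
      nth_rw 2 [hP₂]
      rw [Matrix.mul_add, Matrix.mul_add, ← Matrix.mul_assoc, ← Matrix.mul_assoc,
        ← Matrix.mul_assoc, hP₂Γ, hP₂B₂, hP₂Z, ← hP₂]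
    rw [add_mulVec_eq_two_smul_iff hP₁s hP₁i hP₂s hP₂i, Submodule.mem_inf, ← hS₁, ← hS₂]
    refine and_congr (mulVec_eq_self_iff_mem_span ?_ (fun y => ?_) x)
      (mulVec_eq_self_iff_mem_span ?_ (fun y => ?_) x)
    · rintro v (hv | hv)
      · exact mulVec_eq_self_of_mem_range_transpose hP₁Γ hv
      · exact mulVec_eq_self_of_mem_range_transpose hP₁B₁ hv
    · rw [hP₁, Submodule.span_union, Matrix.add_mulVec, ← Matrix.mulVec_mulVec,
        ← Matrix.mulVec_mulVec]
      exact Submodule.add_mem_sup (mulVec_mem_span_range_transpose _ _)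
        (mulVec_mem_span_range_transpose _ _)
    · rintro v ((hv | hv) | hv)
      · exact mulVec_eq_self_of_mem_range_transpose hP₂Γ hv
      · exact mulVec_eq_self_of_mem_range_transpose hP₂B₂ hv
      · exact mulVec_eq_self_of_mem_range_transpose hP₂Z hv
    · rw [hP₂, Submodule.span_union, Submodule.span_union, Matrix.add_mulVec, Matrix.add_mulVec,
        ← Matrix.mulVec_mulVec, ← Matrix.mulVec_mulVec, ← Matrix.mulVec_mulVec]
      exact Submodule.add_mem_sup (Submodule.add_mem_sup (mulVec_mem_span_range_transpose _ _)
        (mulVec_mem_span_range_transpose _ _)) (mulVec_mem_span_range_transpose _ _)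
  · rw [hadd]
    refine mul_colNormalize_of_mul_eq hM ?_
    rw [← hadd]
    simp only [Matrix.add_mul, Matrix.mul_add, Matrix.mul_one, hP₁B₁, hP₁B₂, hP₂B₁, hP₂B₂]
    abel
  · rw [hsub]
    refine mul_colNormalize_of_mul_eq hD ?_
    rw [← hsub]
    simp only [Matrix.add_mul, Matrix.mul_sub, Matrix.sub_mul, Matrix.mul_one, hP₁B₁, hP₁B₂,
      hP₂B₁, hP₂B₂]
    abel
  · rw [Matrix.add_mul, hP₁Z, hP₂Z, zero_add]
  · intro x hx
    have h₁ : ∀ y ∈ Set.range Γᵀ ∪ Set.range B₁ᵀ, x ⬝ᵥ y = 0 := fun y hy =>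
      hx y (Submodule.mem_sup_left (hS₁ ▸ Submodule.subset_span hy))
    have h₂ : ∀ y ∈ Set.range Γᵀ ∪ Set.range B₂ᵀ ∪ Set.range Zᵀ, x ⬝ᵥ y = 0 := fun y hy =>
      hx y (Submodule.mem_sup_right (hS₂ ▸ Submodule.subset_span hy))
    have hΓx := transpose_mulVec_eq_zero fun y hy => h₁ y (Or.inl hy)
    have hB₁x := transpose_mulVec_eq_zero fun y hy => h₁ y (Or.inr hy)
    have hB₂x := transpose_mulVec_eq_zero fun y hy => h₂ y (Or.inl (Or.inr hy))
    have hZx := transpose_mulVec_eq_zero fun y hy => h₂ y (Or.inr hy)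
    simp [hP₁, hP₂, Matrix.add_mulVec, ← Matrix.mulVec_mulVec, hΓx, hB₁x, hB₂x, hZx]
end

section
/- The range of the averaged projection matrix G = ∫₀¹ l(t) l(t)ᵀ dt equals the range of H = l(0) l(0)ᵀ + l(1) l(1)ᵀ. In particular, the sum subspace of the endpoints span(l(0)) + span(l(1)) equals the span of the union of all subspaces span(l(t)), t ∈ [0,1], lying on the geodesic: every subspace on the geodesic through span(l(0)) and span(l(1)) is contained in their sum subspace, and together they span exactly that sum subspace. -/
open Matrix

/-- For symmetric matrices, inclusion of kernels reverses to inclusion of ranges. -/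
theorem Matrix.IsSymm.range_mulVecLin_le {ι K : Type*} [Fintype ι] [Field K]
    {A B : Matrix ι ι K} (hA : A.IsSymm) (hB : B.IsSymm)
    (h : ∀ x, A *ᵥ x = 0 → B *ᵥ x = 0) :
    LinearMap.range B.mulVecLin ≤ LinearMap.range A.mulVecLin := by
  classical
  rw [Matrix.range_mulVecLin, Submodule.span_le]
  rintro _ ⟨j, rfl⟩
  have hker : ⨅ i, LinearMap.ker (LinearMap.proj i ∘ₗ A.mulVecLin)
      ≤ LinearMap.ker (LinearMap.proj j ∘ₗ B.mulVecLin) := by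
    intro x hx
    simp only [Submodule.mem_iInf, LinearMap.mem_ker, LinearMap.comp_apply, LinearMap.proj_apply,
      Matrix.mulVecLin_apply] at hx ⊢
    exact congrFun (h x (funext hx)) j
  obtain ⟨c, hc⟩ :=
    (Submodule.mem_span_range_iff_exists_fun K).1 (mem_span_of_iInf_ker_le_ker hker)
  refine ⟨c, funext fun k => ?_⟩
  have hk := LinearMap.congr_fun hc (Pi.single k 1)
  simp only [LinearMap.sum_apply, LinearMap.smul_apply, LinearMap.comp_apply,
    Matrix.mulVecLin_apply, LinearMap.proj_apply, Matrix.mulVec_single_one, Matrix.col_apply,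
    smul_eq_mul] at hk
  rw [Matrix.mulVecLin_apply, Matrix.col_apply, hB.apply j k, ← hk]
  exact Finset.sum_congr rfl fun i _ => by simp only [hA.apply i k, mul_comm]

theorem Matrix.dotProduct_mul_transpose_mulVec {ι κ R : Type*} [Fintype ι] [Fintype κ]
    [CommSemiring R] (A : Matrix ι κ R) (x : ι → R) :
    x ⬝ᵥ ((A * Aᵀ) *ᵥ x) = (Aᵀ *ᵥ x) ⬝ᵥ (Aᵀ *ᵥ x) := by
  rw [← Matrix.mulVec_mulVec, Matrix.dotProduct_mulVec, Matrix.mulVec_transpose]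

/-- The kernel of a sum of two Gram matrices is the intersection of the two left kernels. -/
theorem Matrix.mul_transpose_add_mul_transpose_mulVec_eq_zero {ι κ : Type*} [Fintype ι]
    [Fintype κ] {A B : Matrix ι κ ℝ} {x : ι → ℝ} :
    (A * Aᵀ + B * Bᵀ) *ᵥ x = 0 ↔ Aᵀ *ᵥ x = 0 ∧ Bᵀ *ᵥ x = 0 := by
  constructor
  · intro h
    have hq := congrArg (x ⬝ᵥ ·) h
    simp only [Matrix.add_mulVec, dotProduct_add, Matrix.dotProduct_mul_transpose_mulVec,
      dotProduct_zero] at hq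
    have nonneg (v : κ → ℝ) : 0 ≤ v ⬝ᵥ v := Finset.sum_nonneg fun i _ => mul_self_nonneg _
    have hA := nonneg (Aᵀ *ᵥ x)
    have hB := nonneg (Bᵀ *ᵥ x)
    exact ⟨dotProduct_self_eq_zero.1 (by linarith), dotProduct_self_eq_zero.1 (by linarith)⟩
  · rintro ⟨hA, hB⟩
    rw [Matrix.add_mulVec, ← Matrix.mulVec_mulVec, ← Matrix.mulVec_mulVec, hA, hB]
    simp

/-- The kernel of the average of a continuous family of Gram matrices consists of the vectors
annihilated by every member of the family. -/
theorem Matrix.integral_mul_transpose_mulVec_eq_zero {ι κ : Type*} [Fintype ι] [Fintype κ]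
    {l : ℝ → Matrix ι κ ℝ} (hl : Continuous l) {a b : ℝ} (hab : a < b) {x : ι → ℝ} :
    (Matrix.of fun i j => ∫ t in a..b, (l t * (l t)ᵀ) i j) *ᵥ x = 0 ↔
      ∀ t ∈ Set.Icc a b, (l t)ᵀ *ᵥ x = 0 := by
  have hmul (i : ι) :
      ((Matrix.of fun i j => ∫ t in a..b, (l t * (l t)ᵀ) i j) *ᵥ x) i
        = ∫ t in a..b, ((l t * (l t)ᵀ) *ᵥ x) i := by
    simp only [Matrix.mulVec, dotProduct, Matrix.of_apply]
    rw [intervalIntegral.integral_finsetSum]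
    · simp
    · exact fun j _ => Continuous.intervalIntegrable (by fun_prop) _ _
  constructor
  · intro h
    by_contra! hne
    obtain ⟨t, ht, hne⟩ := hne
    have hpos : 0 < ∫ t in a..b, ((l t)ᵀ *ᵥ x) ⬝ᵥ ((l t)ᵀ *ᵥ x) := by
      refine intervalIntegral.integral_pos hab (by fun_prop)
        (fun s _ => Finset.sum_nonneg fun i _ => mul_self_nonneg _) ⟨t, ht, ?_⟩
      exact lt_of_le_of_ne (Finset.sum_nonneg fun i _ => mul_self_nonneg _)
        fun h0 => hne (dotProduct_self_eq_zero.1 h0.symm)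
    refine hpos.ne' ?_
    simp only [← Matrix.dotProduct_mul_transpose_mulVec]
    simp only [dotProduct]
    rw [intervalIntegral.integral_finsetSum]
    · refine Finset.sum_eq_zero fun i _ => ?_
      rw [intervalIntegral.integral_const_mul, ← hmul, h, Pi.zero_apply, mul_zero]
    · exact fun j _ => Continuous.intervalIntegrable (by fun_prop) _ _
  · intro h
    funext i
    rw [hmul, Pi.zero_apply]
    refine intervalIntegral.integral_zero_ae (Filter.Eventually.of_forall fun t ht => ?_)
    rw [Set.uIoc_of_le hab.le] at ht
    rw [← Matrix.mulVec_mulVec, h t (Set.Ioc_subset_Icc_self ht), Matrix.mulVec_zero,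
      Pi.zero_apply]

/-- Spherical interpolation: the point at time `t` on the arc `cos (t θ) • a - sin (t θ) • b` is a
linear combination of the points at times `0` and `1`. -/
theorem Real.cos_smul_sub_sin_smul_eq {E : Type*} [AddCommGroup E] [Module ℝ E] (a b : E)
    {θ : ℝ} (hθ : Real.sin θ ≠ 0) (t : ℝ) :
    Real.cos (t * θ) • a - Real.sin (t * θ) • b
      = (Real.sin ((1 - t) * θ) / Real.sin θ) • a
        + (Real.sin (t * θ) / Real.sin θ) • (Real.cos θ • a - Real.sin θ • b) := by
  have hsub : Real.sin ((1 - t) * θ)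
      = Real.sin θ * Real.cos (t * θ) - Real.cos θ * Real.sin (t * θ) := by
    rw [sub_mul, one_mul, Real.sin_sub]
  rw [hsub]
  match_scalars <;> field_simp
  ring


/-- For the Grassmann geodesic `t ↦ span(l(t))` with
`l(t) = ΦU cos(tΘ) − Φ̄Ū sin(tΘ)` and canonical angles `θ_k ∈ (0, π/2)`, the range of the
averaged projection matrix `G = ∫₀¹ l(t) l(t)ᵀ dt` equals the range of
`H = l(0)l(0)ᵀ + l(1)l(1)ᵀ`.  In particular the sum subspace `span(l(0)) + span(l(1))` of the
endpoints equals the span of the union of all the subspaces `span(l(t))`, `t ∈ [0,1]`, lying on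
the geodesic. -/
theorem second_order_DS_stmt15 {n d : ℕ}
    (Φ : Matrix (Fin n) (Fin d) ℝ) (Φb : Matrix (Fin n) (Fin (n - d)) ℝ)
    (U : Matrix (Fin d) (Fin d) ℝ) (Ub : Matrix (Fin (n - d)) (Fin d) ℝ)
    (θ : Fin d → ℝ) (hθ : ∀ k, θ k ∈ Set.Ioo (0 : ℝ) (Real.pi / 2))
    (hΦ : Φᵀ * Φ = 1) (hΦb : Φbᵀ * Φb = 1) (hmix : Φᵀ * Φb = 0)
    (hU : Uᵀ * U = 1) (hU' : U * Uᵀ = 1) (hUb : Ubᵀ * Ub = 1)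
    (l : ℝ → Matrix (Fin n) (Fin d) ℝ)
    (hl : ∀ t, l t = Φ * U * Matrix.diagonal (fun k => Real.cos (t * θ k))
        - Φb * Ub * Matrix.diagonal (fun k => Real.sin (t * θ k)))
    (G : Matrix (Fin n) (Fin n) ℝ)
    (hG : ∀ i j, G i j = ∫ t in (0 : ℝ)..1, (l t * (l t)ᵀ) i j) :
    LinearMap.range G.mulVecLin
      = LinearMap.range (l 0 * (l 0)ᵀ + l 1 * (l 1)ᵀ).mulVecLin ∧
    Submodule.span ℝ (Set.range (l 0)ᵀ) ⊔ Submodule.span ℝ (Set.range (l 1)ᵀ)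
      = ⨆ t ∈ Set.Icc (0 : ℝ) 1, Submodule.span ℝ (Set.range (l t)ᵀ) := by
  have hcol (t : ℝ) (k : Fin d) : (l t)ᵀ k =
      Real.cos (t * θ k) • (Φ * U)ᵀ k - Real.sin (t * θ k) • (Φb * Ub)ᵀ k := by
    funext i
    simp [hl, Matrix.mul_diagonal, mul_comm, -Matrix.transpose_mul]
  have hcomb (t : ℝ) (k : Fin d) : (l t)ᵀ k =
      (Real.sin ((1 - t) * θ k) / Real.sin (θ k)) • (l 0)ᵀ k
        + (Real.sin (t * θ k) / Real.sin (θ k)) • (l 1)ᵀ k := by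
    have hsin : Real.sin (θ k) ≠ 0 :=
      (Real.sin_pos_of_pos_of_lt_pi (hθ k).1 (by linarith [(hθ k).1, (hθ k).2])).ne'
    simpa [hcol] using
      Real.cos_smul_sub_sin_smul_eq ((Φ * U)ᵀ k) ((Φb * Ub)ᵀ k) hsin t
  have hcont : Continuous l := by
    rw [funext hl]
    fun_prop
  have hGdef : G = Matrix.of fun i j => ∫ t in (0 : ℝ)..1, (l t * (l t)ᵀ) i j :=
    Matrix.ext hG
  have hgram (t : ℝ) : (l t * (l t)ᵀ).IsSymm := by
    rw [Matrix.IsSymm, Matrix.transpose_mul, Matrix.transpose_transpose]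
  have hGsymm : G.IsSymm := by
    refine Matrix.IsSymm.ext fun i j => ?_
    rw [hG, hG]
    exact intervalIntegral.integral_congr fun t _ => (hgram t).apply i j
  have hHsymm : (l 0 * (l 0)ᵀ + l 1 * (l 1)ᵀ).IsSymm :=
    (hgram 0).add (hgram 1)
  have hker (x : Fin n → ℝ) : G *ᵥ x = 0 ↔ (l 0 * (l 0)ᵀ + l 1 * (l 1)ᵀ) *ᵥ x = 0 := by
    rw [hGdef, Matrix.integral_mul_transpose_mulVec_eq_zero hcont one_pos,
      Matrix.mul_transpose_add_mul_transpose_mulVec_eq_zero]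
    refine ⟨fun h => ⟨h 0 (by simp), h 1 (by simp)⟩, fun ⟨h0, h1⟩ t _ => funext fun k => ?_⟩
    have h0k : (l 0)ᵀ k ⬝ᵥ x = 0 := congrFun h0 k
    have h1k : (l 1)ᵀ k ⬝ᵥ x = 0 := congrFun h1 k
    change (l t)ᵀ k ⬝ᵥ x = 0
    rw [hcomb, add_dotProduct, smul_dotProduct, smul_dotProduct, h0k, h1k, smul_zero, smul_zero,
      add_zero]
  refine ⟨le_antisymm (hHsymm.range_mulVecLin_le hGsymm fun x => (hker x).2)
    (hGsymm.range_mulVecLin_le hHsymm fun x => (hker x).1), le_antisymm ?_ ?_⟩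
  · exact sup_le
      (le_iSup₂_of_le (f := fun t (_ : t ∈ Set.Icc (0 : ℝ) 1) =>
        Submodule.span ℝ (Set.range (l t)ᵀ)) 0 (by simp) le_rfl)
      (le_iSup₂_of_le (f := fun t (_ : t ∈ Set.Icc (0 : ℝ) 1) =>
        Submodule.span ℝ (Set.range (l t)ᵀ)) 1 (by simp) le_rfl)
  · refine iSup₂_le fun t _ => Submodule.span_le.2 ?_
    rintro _ ⟨k, rfl⟩
    rw [hcomb t k]
    exact Submodule.add_mem_sup
      (Submodule.smul_mem _ _ (Submodule.subset_span (Set.mem_range_self k)))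
      (Submodule.smul_mem _ _ (Submodule.subset_span (Set.mem_range_self k)))
end
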